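/- Let σ be drawn from the quadratic interaction model ℙ with ‖A_n‖ ≤ h < ∞, let γ ∈ ℝⁿ be deterministic, let g : [−1,1] → ℝ be bounded measurable, and let b_i^{(g)} := E[g(σ_i) | σ_j, j ≠ i]. Then E|Σ_i γ_i (g(σ_i) − b_i^{(g)}) b_i^{(g)}|² ≤ C·Σ_i γ_i², where C depends only on h and ‖g‖_∞ but not on γ. -/

import Mathlib

open MeasureTheory ProbabilityTheory Filter Matrix Set
open scoped ENNReal NNReal BigOperators Topology

noncomputable section

/-- The ℓ^r norm of a vector in ℝⁿ (sup-norm when `r = ∞`). -/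
def pNorm {n : ℕ} (r : ℝ≥0∞) (v : Fin n → ℝ) : ℝ :=
  if r = ∞ then ⨆ i, |v i| else (∑ i, |v i| ^ r.toReal) ^ (1 / r.toReal)

/-- The (r,r)-operator norm of a square real matrix. -/
def opNorm {n : ℕ} (r : ℝ≥0∞) (M : Matrix (Fin n) (Fin n) ℝ) : ℝ :=
  sSup {x | ∃ v : Fin n → ℝ, pNorm r v ≤ 1 ∧ x = pNorm r (M.mulVec v)}

/-- Log-moment generating function of a measure on ℝ. -/
def logMGF (ν : Measure ℝ) (θ : ℝ) : ℝ := Real.log (∫ z, Real.exp (θ * z) ∂ν)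

/-- ψ' -/
def psiD (ν : Measure ℝ) : ℝ → ℝ := deriv (logMGF ν)

/-- ψ'' -/
def psiDD (ν : Measure ℝ) : ℝ → ℝ := deriv (deriv (logMGF ν))

/-- φ, the inverse of ψ'. -/
def phiFn (ν : Measure ℝ) : ℝ → ℝ := Function.invFun (psiD ν)

/-- Rate function I(z) = z φ(z) − ψ(φ(z)). -/
def rateFn (ν : Measure ℝ) (z : ℝ) : ℝ := z * phiFn ν z - logMGF ν (phiFn ν z)

/-- Base-measure assumptions: a non-degenerate probability measure supported on [-1,1]
with both -1 and 1 in its support. -/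
structure GoodBase (ν : Measure ℝ) : Prop where
  prob : IsProbabilityMeasure ν
  supp : ν (Set.Icc (-1 : ℝ) 1)ᶜ = 0
  one_cluster : ∀ ε : ℝ, 0 < ε → 0 < ν (Set.Ioc (1 - ε) 1)
  negone_cluster : ∀ ε : ℝ, 0 < ε → 0 < ν (Set.Ico (-1 : ℝ) (-1 + ε))

/-- Hamiltonian ½ σᵀAσ + cᵀσ. -/
def ham {n : ℕ} (A : Matrix (Fin n) (Fin n) ℝ) (c σ : Fin n → ℝ) : ℝ :=
  (1 / 2) * ∑ i, σ i * A.mulVec σ i + ∑ i, c i * σ i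

/-- The quadratic interaction (Gibbs) measure. -/
def gibbs {n : ℕ} (μ : Fin n → Measure ℝ) (A : Matrix (Fin n) (Fin n) ℝ) (c : Fin n → ℝ) :
    Measure (Fin n → ℝ) :=
  (ENNReal.ofReal (∫ σ, Real.exp (ham A c σ) ∂(Measure.pi μ)))⁻¹ •
    ((Measure.pi μ).withDensity fun σ => ENNReal.ofReal (Real.exp (ham A c σ)))

/-- The cube [-1,1]ⁿ. -/
def cube (n : ℕ) : Set (Fin n → ℝ) := {z | ∀ i, z i ∈ Set.Icc (-1 : ℝ) 1}

/-- Mean-field functional F(z) = ½ zᵀAz + cᵀz − Σ I_i(z_i). -/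
def mfF {n : ℕ} (μ : Fin n → Measure ℝ) (A : Matrix (Fin n) (Fin n) ℝ) (c z : Fin n → ℝ) : ℝ :=
  (1 / 2) * ∑ i, z i * A.mulVec z i + ∑ i, c i * z i - ∑ i, rateFn (μ i) (z i)

/-- Being a mean-field maximizer over the cube. -/
def IsMFMax {n : ℕ} (μ : Fin n → Measure ℝ) (A : Matrix (Fin n) (Fin n) ℝ) (c u : Fin n → ℝ) :
    Prop := u ∈ cube n ∧ IsMaxOn (mfF μ A c) (cube n) u

open scoped Classical in
/-- The mean-field maximizer (chosen by choice when one exists). -/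
def mfMax {n : ℕ} (μ : Fin n → Measure ℝ) (A : Matrix (Fin n) (Fin n) ℝ) (c : Fin n → ℝ) :
    Fin n → ℝ :=
  if h : ∃ u, IsMFMax μ A c u then h.choose else 0

/-- α_n = max_i Σ_j A(i,j)². -/
def alphaMax {n : ℕ} (A : Matrix (Fin n) (Fin n) ℝ) : ℝ := ⨆ i, ∑ j, A i j ^ 2

/-- Kolmogorov-Smirnov distance between two laws on ℝ. -/
def dKS (μ ν : Measure ℝ) : ℝ :=
  ⨆ t : ℝ, |(μ (Set.Iic t)).toReal - (ν (Set.Iic t)).toReal|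

/-- υ_n = Σ_i q_i² ψ''_i(c_i). -/
def upsilonQ {n : ℕ} (μ : Fin n → Measure ℝ) (c q : Fin n → ℝ) : ℝ :=
  ∑ i, q i ^ 2 * psiDD (μ i) (c i)

/-- ν_i = Σ_j A(i,j) ψ'_j(c_j). -/
def nuVec {n : ℕ} (μ : Fin n → Measure ℝ) (A : Matrix (Fin n) (Fin n) ℝ) (c : Fin n → ℝ) :
    Fin n → ℝ := fun i => ∑ j, A i j * psiD (μ j) (c j)

def R1 {n : ℕ} (μ : Fin n → Measure ℝ) (A : Matrix (Fin n) (Fin n) ℝ) (c q : Fin n → ℝ) : ℝ :=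
  ∑ i, (∑ j, A i j * q j * (psiDD (μ j) (c j) - upsilonQ μ c q)) ^ 2

def R2 {n : ℕ} (μ : Fin n → Measure ℝ) (A : Matrix (Fin n) (Fin n) ℝ) (c : Fin n → ℝ) : ℝ :=
  ∑ i, nuVec μ A c i ^ 2

def R3 {n : ℕ} (μ : Fin n → Measure ℝ) (A : Matrix (Fin n) (Fin n) ℝ) (c : Fin n → ℝ) : ℝ :=
  ∑ i, nuVec μ A c i ^ 4

def R4 {n : ℕ} (μ : Fin n → Measure ℝ) (A : Matrix (Fin n) (Fin n) ℝ) (c q : Fin n → ℝ) : ℝ :=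
  |∑ i, ∑ j, A i j * q i * (psiDD (μ i) (c i) - upsilonQ μ c q) * psiD (μ j) (c j)|

/-- ε = A q − λ q. -/
def epsVec {n : ℕ} (A : Matrix (Fin n) (Fin n) ℝ) (q : Fin n → ℝ) (lam : ℝ) : Fin n → ℝ :=
  fun i => A.mulVec q i - lam * q i

/-- Product of two measures via bind (the joint law of an independent pair). -/
def mprod {α β : Type*} [MeasurableSpace α] [MeasurableSpace β]
    (μ : Measure α) (ν : Measure β) : Measure (α × β) :=
  μ.bind fun a => ν.map (Prod.mk a)

abbrev pairIdx (n : ℕ) := {ij : Fin n × Fin n // ij.1 < ij.2}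

/-- Bernoulli(p) as a measure on ℝ (point masses at 0 and 1). -/
def bern (p : ℝ) : Measure ℝ :=
  ENNReal.ofReal (1 - p) • Measure.dirac 0 + ENNReal.ofReal p • Measure.dirac 1

/-- Symmetrization of edge indicators into an adjacency function with zero diagonal. -/
def symFun {n : ℕ} (w : pairIdx n → ℝ) : Fin n → Fin n → ℝ := fun i j =>
  if h : i < j then w ⟨(i, j), h⟩ else if h' : j < i then w ⟨(j, i), h'⟩ else 0

/-- Erdős–Rényi law on adjacency functions. -/
def erLaw (n : ℕ) (p : ℝ) : Measure (Fin n → Fin n → ℝ) :=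
  (Measure.pi fun _ : pairIdx n => bern p).map symFun

/-- Uniform distribution on [0,1]. -/
def unif01 : Measure ℝ := volume.restrict (Set.Icc (0 : ℝ) 1)

/-- Symmetric Rademacher distribution. -/
def rademacher : Measure ℝ :=
  (2 : ℝ≥0∞)⁻¹ • Measure.dirac (-1) + (2 : ℝ≥0∞)⁻¹ • Measure.dirac 1

/-- Joint law of (U, G) for f-random graphs with sparsity n^{-γ}. -/
def fGraphLaw (n : ℕ) (f : ℝ → ℝ → ℝ) (γ : ℝ) :
    Measure ((Fin n → ℝ) × (Fin n → Fin n → ℝ)) :=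
  (Measure.pi fun _ : Fin n => unif01).bind fun U =>
    (Measure.pi fun ij : pairIdx n => bern (f (U ij.1.1) (U ij.1.2) / (n : ℝ) ^ γ)).map
      fun w => (U, symFun w)

/-- The (diluted) Hopfield coupling matrix θ·M_n(i,j)·G_n(i,j), M_n = ZᵀZ/N. -/
def hopA (N : ℕ) {n : ℕ} (θ : ℝ) (G : Fin n → Fin n → ℝ) (Z : Fin N × Fin n → ℝ) :
    Matrix (Fin n) (Fin n) ℝ :=
  Matrix.of fun i j => θ * ((N : ℝ)⁻¹ * ∑ k : Fin N, Z (k, i) * Z (k, j)) * G i j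

/-- σ-algebra generated by the coordinates other than i. -/
def exceptSigma (n : ℕ) (i : Fin n) : MeasurableSpace (Fin n → ℝ) :=
  MeasurableSpace.comap (fun σ => Function.update σ i 0) inferInstance

/-- Conditional expectation of g(σ_i) given the other coordinates, under the Gibbs measure. -/
def condB {n : ℕ} (μ : Fin n → Measure ℝ) (A : Matrix (Fin n) (Fin n) ℝ) (c : Fin n → ℝ)
    (g : ℝ → ℝ) (i : Fin n) : (Fin n → ℝ) → ℝ :=
  (gibbs μ A c)[(fun σ => g (σ i)) | exceptSigma n i]

end

/-- The exponentially weighted integral `∫ f(z) e^{θz} dν(z)`. -/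
noncomputable def expInt (ν : Measure ℝ) (f : ℝ → ℝ) (θ : ℝ) : ℝ :=
  ∫ z, f z * Real.exp (θ * z) ∂ν

/-- The mean of `f` under the exponential tilt of `ν` with parameter `θ`. -/
noncomputable def expMean (ν : Measure ℝ) (f : ℝ → ℝ) (θ : ℝ) : ℝ :=
  expInt ν f θ / expInt ν (fun _ => 1) θ

/-- The derivative in `θ` of `expMean ν f θ`: the tilted covariance of `f` and the identity. -/
noncomputable def expMeanDeriv (ν : Measure ℝ) (f : ℝ → ℝ) (θ : ℝ) : ℝ :=
  expMean ν (fun z => f z * z) θ - expMean ν f θ * expMean ν (fun z => z) θ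

/-- The second derivative in `θ` of `expMean ν f θ`. -/
noncomputable def expMeanDerivTwo (ν : Measure ℝ) (f : ℝ → ℝ) (θ : ℝ) : ℝ :=
  expMeanDeriv ν (fun z => f z * z) θ -
    (expMeanDeriv ν f θ * expMean ν (fun z => z) θ +
      expMean ν f θ * expMeanDeriv ν (fun z => z) θ)

lemma ae_abs_mul_self_le {ν : Measure ℝ} {f : ℝ → ℝ} {M : ℝ} (hν : ∀ᵐ z ∂ν, |z| ≤ 1)
    (hM : ∀ᵐ z ∂ν, |f z| ≤ M) : ∀ᵐ z ∂ν, |f z * z| ≤ M := by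
  filter_upwards [hν, hM] with z hz hfz
  rw [abs_mul]
  nlinarith [abs_nonneg (f z), abs_nonneg z]

section Tilt

variable {ν : Measure ℝ} [IsProbabilityMeasure ν] {f : ℝ → ℝ} {M : ℝ}

lemma exp_mul_le_of_abs_le_one {θ z : ℝ} (hz : |z| ≤ 1) : Real.exp (θ * z) ≤ Real.exp |θ| := by
  apply Real.exp_le_exp.2
  calc θ * z ≤ |θ * z| := le_abs_self _
    _ = |θ| * |z| := abs_mul _ _
    _ ≤ |θ| * 1 := by gcongr
    _ = |θ| := mul_one _

lemma integrable_mul_exp (hν : ∀ᵐ z ∂ν, |z| ≤ 1) (hf : Measurable f)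
    (hM : ∀ᵐ z ∂ν, |f z| ≤ M) (θ : ℝ) : Integrable (fun z => f z * Real.exp (θ * z)) ν := by
  refine Integrable.of_bound (by fun_prop) (M * Real.exp |θ|) ?_
  filter_upwards [hν, hM] with z hz hfz
  rw [Real.norm_eq_abs, abs_mul, Real.abs_exp]
  have := exp_mul_le_of_abs_le_one (θ := θ) hz
  have := (abs_nonneg (f z)).trans hfz
  gcongr

lemma hasDerivAt_expInt (hν : ∀ᵐ z ∂ν, |z| ≤ 1) (hf : Measurable f)
    (hM : ∀ᵐ z ∂ν, |f z| ≤ M) (θ : ℝ) :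
    HasDerivAt (expInt ν f) (expInt ν (fun z => f z * z) θ) θ := by
  refine (hasDerivAt_integral_of_dominated_loc_of_deriv_le (F := fun θ z => f z * Real.exp (θ * z))
    (F' := fun θ z => f z * z * Real.exp (θ * z)) (bound := fun _ => M * Real.exp (|θ| + 1))
    (Metric.ball_mem_nhds θ one_pos) (Eventually.of_forall fun t => by fun_prop)
    (integrable_mul_exp hν hf hM θ) (by fun_prop) ?_ (integrable_const _) ?_).2
  · filter_upwards [hν, hM] with z hz hfz t ht
    rw [Real.norm_eq_abs, abs_mul, Real.abs_exp, abs_mul]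
    have h1 := exp_mul_le_of_abs_le_one (θ := t) hz
    have h2 : |t| ≤ |θ| + 1 := by
      rw [Metric.mem_ball, Real.dist_eq] at ht
      have := abs_sub_abs_le_abs_sub t θ
      linarith
    have h3 := (abs_nonneg (f z)).trans hfz
    have h4 := h1.trans (Real.exp_le_exp.2 h2)
    calc |f z| * |z| * Real.exp (t * z) ≤ M * 1 * Real.exp (|θ| + 1) :=
          mul_le_mul (mul_le_mul hfz hz (abs_nonneg _) h3) h4 (Real.exp_pos _).le (by linarith)
      _ = _ := by ring
  · refine Eventually.of_forall fun z t _ => ?_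
    have := (((hasDerivAt_id t).mul_const z).exp).const_mul (f z)
    refine this.congr_deriv ?_
    simp only [id]
    ring

lemma expInt_one_pos (hν : ∀ᵐ z ∂ν, |z| ≤ 1) (θ : ℝ) : 0 < expInt ν (fun _ => 1) θ := by
  have hi := integrable_mul_exp (f := fun _ => 1) (M := 1) hν measurable_const (by simp) θ
  simp only [expInt, one_mul] at hi ⊢
  exact integral_exp_pos hi

lemma abs_expMean_le (hν : ∀ᵐ z ∂ν, |z| ≤ 1) (hM : ∀ᵐ z ∂ν, |f z| ≤ M) (θ : ℝ) :
    |expMean ν f θ| ≤ M := by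
  have hi := integrable_mul_exp (f := fun _ => 1) (M := 1) hν measurable_const (by simp) θ
  rw [expMean, abs_div, abs_of_pos (expInt_one_pos hν θ), div_le_iff₀ (expInt_one_pos hν θ)]
  rw [expInt, expInt, ← integral_const_mul, ← Real.norm_eq_abs]
  refine norm_integral_le_of_norm_le (hi.const_mul M) ?_
  filter_upwards [hM] with z hz
  rw [Real.norm_eq_abs, abs_mul, Real.abs_exp, one_mul]
  gcongr

lemma hasDerivAt_expMean (hν : ∀ᵐ z ∂ν, |z| ≤ 1) (hf : Measurable f)
    (hM : ∀ᵐ z ∂ν, |f z| ≤ M) (θ : ℝ) :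
    HasDerivAt (expMean ν f) (expMeanDeriv ν f θ) θ := by
  have h0 := (expInt_one_pos hν θ).ne'
  have := (hasDerivAt_expInt hν hf hM θ).div
    (hasDerivAt_expInt (f := fun _ => 1) (M := 1) hν measurable_const (by simp) θ) h0
  refine this.congr_deriv ?_
  simp only [expMeanDeriv, expMean, one_mul]
  field_simp

lemma hasDerivAt_expMeanDeriv (hν : ∀ᵐ z ∂ν, |z| ≤ 1) (hf : Measurable f)
    (hM : ∀ᵐ z ∂ν, |f z| ≤ M) (θ : ℝ) :
    HasDerivAt (expMeanDeriv ν f) (expMeanDerivTwo ν f θ) θ :=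
  (hasDerivAt_expMean hν (by fun_prop) (ae_abs_mul_self_le hν hM) θ).sub
    ((hasDerivAt_expMean hν hf hM θ).mul
      (hasDerivAt_expMean (f := fun z => z) hν measurable_id hν θ))

lemma abs_expMeanDeriv_le (hν : ∀ᵐ z ∂ν, |z| ≤ 1) (hM : ∀ᵐ z ∂ν, |f z| ≤ M) (θ : ℝ) :
    |expMeanDeriv ν f θ| ≤ 2 * M := by
  have h1 := abs_expMean_le hν (ae_abs_mul_self_le hν hM) θ
  have h2 := abs_expMean_le hν hM θ
  have h3 := abs_expMean_le (f := fun z => z) hν hν θ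
  have h4 : |expMean ν f θ * expMean ν (fun z => z) θ| ≤ M * 1 := by
    rw [abs_mul]
    have := (abs_nonneg _).trans h2
    gcongr
  have := abs_sub (expMean ν (fun z => f z * z) θ) (expMean ν f θ * expMean ν (fun z => z) θ)
  rw [expMeanDeriv]
  linarith

lemma abs_expMeanDerivTwo_le (hν : ∀ᵐ z ∂ν, |z| ≤ 1) (hM : ∀ᵐ z ∂ν, |f z| ≤ M) (θ : ℝ) :
    |expMeanDerivTwo ν f θ| ≤ 6 * M := by
  have h1 := abs_expMeanDeriv_le hν (ae_abs_mul_self_le hν hM) θ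
  have h2 := abs_expMean_le hν hM θ
  have h0 := (abs_nonneg _).trans h2
  have h3 := abs_expMean_le (f := fun z => z) hν hν θ
  have h4 : |expMeanDeriv ν f θ * expMean ν (fun z => z) θ| ≤ 2 * M * 1 := by
    rw [abs_mul]
    have := abs_expMeanDeriv_le hν hM θ
    gcongr
  have h5 : |expMean ν f θ * expMeanDeriv ν (fun z => z) θ| ≤ M * (2 * 1) := by
    rw [abs_mul]
    have := abs_expMeanDeriv_le (f := fun z => z) hν hν θ
    gcongr
  rw [expMeanDerivTwo]
  refine (abs_sub _ _).trans ?_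
  have := abs_add_le (expMeanDeriv ν f θ * expMean ν (fun z => z) θ)
    (expMean ν f θ * expMeanDeriv ν (fun z => z) θ)
  linarith

lemma measurable_expMean (hν : ∀ᵐ z ∂ν, |z| ≤ 1) (hf : Measurable f)
    (hM : ∀ᵐ z ∂ν, |f z| ≤ M) : Measurable (expMean ν f) :=
  Continuous.measurable <| continuous_iff_continuousAt.2 fun θ =>
    (hasDerivAt_expMean hν hf hM θ).continuousAt

/-- Centering `f` at its tilted mean makes its exponentially weighted integral vanish. -/
lemma integral_sub_expMean_mul_exp (hν : ∀ᵐ z ∂ν, |z| ≤ 1) (hf : Measurable f)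
    (hM : ∀ᵐ z ∂ν, |f z| ≤ M) (θ : ℝ) :
    ∫ z, (f z - expMean ν f θ) * Real.exp (θ * z) ∂ν = 0 := by
  have hi := integrable_mul_exp (f := fun _ => 1) (M := 1) hν measurable_const (by simp) θ
  have h0 := (expInt_one_pos hν θ).ne'
  have : ∀ z, (f z - expMean ν f θ) * Real.exp (θ * z) =
      f z * Real.exp (θ * z) - expMean ν f θ * (1 * Real.exp (θ * z)) := fun z => by ring
  simp_rw [this]
  rw [integral_sub (integrable_mul_exp hν hf hM θ) (hi.const_mul _), integral_const_mul]
  change expInt ν f θ - expMean ν f θ * expInt ν (fun _ => 1) θ = 0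
  rw [expMean, div_mul_cancel₀ _ h0, sub_self]

end Tilt

/-- Quantitative second-order Taylor estimate on the real line. -/
lemma abs_sub_sub_le_mul_sq {F F' F'' : ℝ → ℝ} {K : ℝ} (hF : ∀ x, HasDerivAt F (F' x) x)
    (hF' : ∀ x, HasDerivAt F' (F'' x) x) (hK : ∀ x, |F'' x| ≤ K) (x t : ℝ) :
    |F (x + t) - F x - t * F' x| ≤ K * t ^ 2 := by
  have hL : ∀ y, |F' y - F' x| ≤ K * |y - x| := fun y =>
    convex_univ.norm_image_sub_le_of_norm_hasDerivWithin_le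
      (fun z _ => (hF' z).hasDerivWithinAt) (fun z _ => hK z) (mem_univ x) (mem_univ y)
  have hK0 : 0 ≤ K := (abs_nonneg _).trans (hK x)
  have := (convex_uIcc x (x + t)).norm_image_sub_le_of_norm_hasDerivWithin_le
    (f := fun y => F y - y * F' x) (f' := fun y => F' y - 1 * F' x) (C := K * |t|)
    (fun z _ => ((hF z).sub ((hasDerivAt_id z).mul_const (F' x))).hasDerivWithinAt)
    (fun z hz => by
      rw [one_mul, Real.norm_eq_abs]
      refine (hL z).trans ?_
      have := abs_sub_left_of_mem_uIcc hz
      rw [add_sub_cancel_left] at this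
      gcongr) left_mem_uIcc right_mem_uIcc
  simp only [Real.norm_eq_abs, add_sub_cancel_left] at this
  calc |F (x + t) - F x - t * F' x| = |F (x + t) - (x + t) * F' x - (F x - x * F' x)| := by
        congr 1; ring
    _ ≤ K * |t| * |t| := this
    _ = K * t ^ 2 := by rw [mul_assoc, abs_mul_abs_self, sq]

section CenteredProduct

variable {ν : Measure ℝ} [IsProbabilityMeasure ν] {g : ℝ → ℝ} {M : ℝ}

/-- The centered and weighted value `(w - b(θ)) b(θ)`, where `b` is the tilted mean of `g`. -/
noncomputable def centeredProd (ν : Measure ℝ) (g : ℝ → ℝ) (w θ : ℝ) : ℝ :=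
  (w - expMean ν g θ) * expMean ν g θ

/-- The derivative of `centeredProd ν g w θ` in `θ`. -/
noncomputable def centeredProdDeriv (ν : Measure ℝ) (g : ℝ → ℝ) (w θ : ℝ) : ℝ :=
  (w - 2 * expMean ν g θ) * expMeanDeriv ν g θ

lemma abs_centeredProd_le (hν : ∀ᵐ z ∂ν, |z| ≤ 1) (hM : ∀ z, |g z| ≤ M) {w : ℝ}
    (hw : |w| ≤ M) (θ : ℝ) : |centeredProd ν g w θ| ≤ 2 * M ^ 2 := by
  have h1 := abs_expMean_le hν (Eventually.of_forall hM) θ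
  have h0 := (abs_nonneg _).trans h1
  have h2 := abs_sub w (expMean ν g θ)
  rw [centeredProd, abs_mul]
  calc _ ≤ (2 * M) * M := by gcongr; linarith
    _ = _ := by ring

lemma abs_centeredProdDeriv_le (hν : ∀ᵐ z ∂ν, |z| ≤ 1) (hM : ∀ z, |g z| ≤ M) {w : ℝ}
    (hw : |w| ≤ M) (θ : ℝ) : |centeredProdDeriv ν g w θ| ≤ 6 * M ^ 2 := by
  have h1 := abs_expMean_le hν (Eventually.of_forall hM) θ
  have h0 := (abs_nonneg _).trans h1
  have h2 := abs_sub w (2 * expMean ν g θ)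
  have h3 := abs_expMeanDeriv_le hν (Eventually.of_forall hM) θ
  rw [abs_mul, abs_two] at h2
  rw [centeredProdDeriv, abs_mul]
  calc _ ≤ (3 * M) * (2 * M) := by gcongr; linarith
    _ = _ := by ring

lemma abs_centeredProd_taylor_le (hν : ∀ᵐ z ∂ν, |z| ≤ 1) (hg : Measurable g)
    (hM : ∀ z, |g z| ≤ M) {w : ℝ} (hw : |w| ≤ M) (θ t : ℝ) :
    |centeredProd ν g w (θ + t) - centeredProd ν g w θ - t * centeredProdDeriv ν g w θ| ≤
      26 * M ^ 2 * t ^ 2 := by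
  have hM' : ∀ᵐ z ∂ν, |g z| ≤ M := Eventually.of_forall hM
  have hb := fun x => hasDerivAt_expMean hν hg hM' x
  have hb' := fun x => hasDerivAt_expMeanDeriv hν hg hM' x
  refine abs_sub_sub_le_mul_sq (F := centeredProd ν g w)
    (F'' := fun x => (w - 2 * expMean ν g x) * expMeanDerivTwo ν g x -
      2 * (expMeanDeriv ν g x * expMeanDeriv ν g x)) (fun x => ?_) (fun x => ?_) (fun x => ?_) θ t
  · refine (((hb x).const_sub w).mul (hb x)).congr_deriv ?_
    rw [centeredProdDeriv]; ring
  · refine ((((hb x).const_mul 2).const_sub w).mul (hb' x)).congr_deriv ?_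
    ring
  · have h1 := abs_expMean_le hν hM' x
    have h0 := (abs_nonneg _).trans h1
    have h2 := abs_sub w (2 * expMean ν g x)
    have h3 := abs_expMeanDeriv_le hν hM' x
    have h4 := abs_expMeanDerivTwo_le hν hM' x
    rw [abs_mul, abs_two] at h2
    refine (abs_sub _ _).trans ?_
    simp only [abs_mul, abs_two]
    calc _ ≤ (3 * M) * (6 * M) + 2 * ((2 * M) * (2 * M)) := by gcongr; linarith
      _ = _ := by ring

end CenteredProduct

section OperatorNorm

variable {n : ℕ}

lemma pNorm_two_eq_norm (v : Fin n → ℝ) : pNorm 2 v = ‖WithLp.toLp 2 v‖ := by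
  rw [pNorm, if_neg (by norm_num), EuclideanSpace.norm_eq, Real.sqrt_eq_rpow]
  simp

lemma norm_mulVec_le_of_opNorm_le {A : Matrix (Fin n) (Fin n) ℝ} {h : ℝ} (hA : opNorm 2 A ≤ h)
    (v : Fin n → ℝ) : ‖WithLp.toLp 2 (A.mulVec v)‖ ≤ h * ‖WithLp.toLp 2 v‖ := by
  have hbdd : BddAbove {x | ∃ v : Fin n → ℝ, pNorm 2 v ≤ 1 ∧ x = pNorm 2 (A.mulVec v)} := by
    refine ⟨‖Matrix.toEuclideanCLM (𝕜 := ℝ) A‖, ?_⟩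
    rintro _ ⟨w, hw, rfl⟩
    rw [pNorm_two_eq_norm] at hw ⊢
    rw [← Matrix.toEuclideanCLM_toLp]
    exact (ContinuousLinearMap.le_opNorm _ _).trans
      (mul_le_of_le_one_right (norm_nonneg _) hw)
  rcases eq_or_ne v 0 with rfl | hv
  · simp
  have hpos : 0 < ‖WithLp.toLp 2 v‖ := by simpa using hv
  have hle : pNorm 2 (A.mulVec (‖WithLp.toLp 2 v‖⁻¹ • v)) ≤ opNorm 2 A := by
    refine le_csSup hbdd ⟨_, ?_, rfl⟩
    rw [pNorm_two_eq_norm, WithLp.toLp_smul, norm_smul, norm_inv, norm_norm,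
      inv_mul_cancel₀ hpos.ne']
  rw [pNorm_two_eq_norm, Matrix.mulVec_smul, WithLp.toLp_smul, norm_smul, norm_inv, norm_norm,
    inv_mul_le_iff₀ hpos] at hle
  exact hle.trans (by rw [mul_comm]; gcongr)

lemma norm_toLp_le_of_abs_le {u γ : Fin n → ℝ} {a : ℝ} (ha : 0 ≤ a)
    (hu : ∀ i, |u i| ≤ a * |γ i|) : ‖WithLp.toLp 2 u‖ ≤ a * ‖WithLp.toLp 2 γ‖ := by
  rw [EuclideanSpace.norm_eq, EuclideanSpace.norm_eq, ← Real.sqrt_sq ha,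
    ← Real.sqrt_mul (sq_nonneg a), Finset.mul_sum]
  refine Real.sqrt_le_sqrt (Finset.sum_le_sum fun i _ => ?_)
  rw [← mul_pow]
  exact pow_le_pow_left₀ (norm_nonneg _) (hu i) 2

lemma sum_mul_mul_le_of_opNorm_le {A : Matrix (Fin n) (Fin n) ℝ} {h : ℝ} (hh : 0 ≤ h)
    (hA : opNorm 2 A ≤ h) {u v γ : Fin n → ℝ} {a b : ℝ} (ha : 0 ≤ a) (hb : 0 ≤ b)
    (hu : ∀ i, |u i| ≤ a * |γ i|) (hv : ∀ i, |v i| ≤ b * |γ i|) :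
    ∑ i, ∑ j, u i * A i j * v j ≤ h * a * b * ∑ i, γ i ^ 2 := by
  have heq : ∑ i, ∑ j, u i * A i j * v j =
      inner ℝ (WithLp.toLp 2 (A.mulVec v)) (WithLp.toLp 2 u) := by
    rw [PiLp.inner_apply]
    refine Finset.sum_congr rfl fun i _ => ?_
    simp [Matrix.mulVec, dotProduct, Finset.mul_sum, mul_assoc]
  have hγ : ‖WithLp.toLp 2 γ‖ ^ 2 = ∑ i, γ i ^ 2 := by
    rw [EuclideanSpace.norm_sq_eq]; simp
  rw [heq]
  calc _ ≤ ‖WithLp.toLp 2 (A.mulVec v)‖ * ‖WithLp.toLp 2 u‖ := real_inner_le_norm _ _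
    _ ≤ (h * (b * ‖WithLp.toLp 2 γ‖)) * (a * ‖WithLp.toLp 2 γ‖) := by
        gcongr
        · exact (norm_mulVec_le_of_opNorm_le hA v).trans
            (by gcongr; exact norm_toLp_le_of_abs_le hb hv)
        · exact norm_toLp_le_of_abs_le ha hu
    _ = _ := by rw [← hγ]; ring

lemma sum_col_sq_le_of_opNorm_le {A : Matrix (Fin n) (Fin n) ℝ} {h : ℝ}
    (hA : opNorm 2 A ≤ h) (j : Fin n) : ∑ i, A i j ^ 2 ≤ h ^ 2 := by
  have := norm_mulVec_le_of_opNorm_le hA (Pi.single j 1)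
  rw [Matrix.mulVec_single_one, PiLp.toLp_single, PiLp.norm_single, norm_one, mul_one] at this
  have h2 := pow_le_pow_left₀ (norm_nonneg _) this 2
  rw [EuclideanSpace.norm_sq_eq] at h2
  simpa using h2

lemma sum_abs_mul_sq_le_of_opNorm_le {A : Matrix (Fin n) (Fin n) ℝ} (hs : A.IsSymm) {h : ℝ}
    (hA : opNorm 2 A ≤ h) (γ : Fin n → ℝ) :
    ∑ i, ∑ j, |γ i| * |γ j| * A i j ^ 2 ≤ h ^ 2 * ∑ i, γ i ^ 2 := by
  have hcol : ∑ i, ∑ j, γ j ^ 2 * A i j ^ 2 ≤ h ^ 2 * ∑ i, γ i ^ 2 := by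
    rw [Finset.sum_comm, Finset.mul_sum]
    refine Finset.sum_le_sum fun j _ => ?_
    rw [← Finset.mul_sum, mul_comm]
    exact mul_le_mul_of_nonneg_right (sum_col_sq_le_of_opNorm_le hA j) (sq_nonneg _)
  have hrow : ∑ i, ∑ j, γ i ^ 2 * A i j ^ 2 ≤ h ^ 2 * ∑ i, γ i ^ 2 := by
    rw [Finset.sum_comm]
    simpa only [hs.apply] using hcol
  have : ∑ i, ∑ j, |γ i| * |γ j| * A i j ^ 2 ≤
      (∑ i, ∑ j, γ i ^ 2 * A i j ^ 2 + ∑ i, ∑ j, γ j ^ 2 * A i j ^ 2) / 2 := by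
    rw [← Finset.sum_add_distrib, Finset.sum_div]
    refine Finset.sum_le_sum fun i _ => ?_
    rw [← Finset.sum_add_distrib, Finset.sum_div]
    refine Finset.sum_le_sum fun j _ => ?_
    have h1 := two_mul_le_add_sq |γ i| |γ j|
    rw [sq_abs, sq_abs] at h1
    nlinarith [sq_nonneg (A i j)]
  linarith

end OperatorNorm

section Hamiltonian

variable {n : ℕ}

lemma update_eq_add_single (σ : Fin n → ℝ) (i : Fin n) (x : ℝ) :
    Function.update σ i x = σ + Pi.single i (x - σ i) := by
  ext k
  rcases eq_or_ne k i with rfl | hk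
  · simp
  · simp [hk]

lemma mulVec_update_apply (A : Matrix (Fin n) (Fin n) ℝ) (σ : Fin n → ℝ) (i j : Fin n) (x : ℝ) :
    A.mulVec (Function.update σ j x) i = A.mulVec σ i + A i j * (x - σ j) := by
  rw [update_eq_add_single, Matrix.mulVec_add, Pi.add_apply, Matrix.mulVec_single]
  simp

/-- The field `c_i + ∑_j A_ij σ_j` acting on the `i`-th coordinate. -/
def localField (A : Matrix (Fin n) (Fin n) ℝ) (c σ : Fin n → ℝ) (i : Fin n) : ℝ :=
  A.mulVec σ i + c i

lemma localField_update (A : Matrix (Fin n) (Fin n) ℝ) (c σ : Fin n → ℝ) (i j : Fin n) (x : ℝ) :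
    localField A c (Function.update σ j x) i = localField A c σ i + A i j * (x - σ j) := by
  rw [localField, mulVec_update_apply, localField]
  ring

lemma localField_update_self {A : Matrix (Fin n) (Fin n) ℝ} {i : Fin n} (hd : A i i = 0)
    (c σ : Fin n → ℝ) (x : ℝ) :
    localField A c (Function.update σ i x) i = localField A c σ i := by
  rw [localField_update, hd, zero_mul, add_zero]

lemma continuous_localField (A : Matrix (Fin n) (Fin n) ℝ) (c : Fin n → ℝ) (i : Fin n) :
    Continuous fun σ => localField A c σ i := by
  unfold localField Matrix.mulVec dotProduct
  fun_prop

lemma continuous_ham (A : Matrix (Fin n) (Fin n) ℝ) (c : Fin n → ℝ) : Continuous (ham A c) := by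
  unfold ham Matrix.mulVec dotProduct
  fun_prop

lemma ham_eq_update_zero_add {A : Matrix (Fin n) (Fin n) ℝ} (hs : A.IsSymm) {i : Fin n}
    (hd : A i i = 0) (c σ : Fin n → ℝ) :
    ham A c σ = ham A c (Function.update σ i 0) + localField A c σ i * σ i := by
  set τ := Function.update σ i 0 with hτ
  have hσ : σ = τ + Pi.single i (σ i) := by
    rw [hτ, update_eq_add_single, add_assoc, ← Pi.single_add]; simp
  have hf : localField A c σ i = A.mulVec τ i + c i := by
    rw [← localField_update_self hd c σ 0, ← hτ, localField]
  have hham : ∀ σ, ham A c σ = 1 / 2 * σ ⬝ᵥ A.mulVec σ + c ⬝ᵥ σ := fun _ => rfl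
  have hsym : τ ⬝ᵥ A.mulVec (Pi.single i (σ i)) = A.mulVec τ i * σ i := by
    rw [Matrix.dotProduct_mulVec, ← Matrix.mulVec_transpose, hs.eq, dotProduct_single]
  rw [hf, hham, hham]
  conv_lhs => rw [hσ]
  rw [Matrix.mulVec_add, dotProduct_add, add_dotProduct, add_dotProduct, hsym, single_dotProduct,
    single_dotProduct, dotProduct_add, dotProduct_single, Matrix.mulVec_single]
  simp [hd]
  ring

lemma ham_update {A : Matrix (Fin n) (Fin n) ℝ} (hs : A.IsSymm) {i : Fin n}
    (hd : A i i = 0) (c σ : Fin n → ℝ) (x : ℝ) :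
    ham A c (Function.update σ i x) =
      ham A c (Function.update σ i 0) + localField A c σ i * x := by
  rw [ham_eq_update_zero_add hs hd, localField_update_self hd]
  simp

end Hamiltonian

section Resampling

/-- Resampling one coordinate independently preserves a product measure. -/
lemma measurePreserving_update_prod {ι : Type*} [Fintype ι] [DecidableEq ι] {α : ι → Type*}
    [∀ i, MeasurableSpace (α i)] (μ : ∀ i, Measure (α i)) [∀ i, IsProbabilityMeasure (μ i)]
    (i : ι) :
    MeasurePreserving (fun p : (∀ j, α j) × α i => Function.update p.1 i p.2)
      ((Measure.pi μ).prod (μ i)) (Measure.pi μ) := by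
  have hmeas : Measurable fun p : (∀ j, α j) × α i => Function.update p.1 i p.2 :=
    measurable_update'
  refine ⟨hmeas, (Measure.pi_eq fun s hs => ?_).symm⟩
  have hpre : (fun p : (∀ j, α j) × α i => Function.update p.1 i p.2) ⁻¹' (Set.univ.pi s) =
      (Set.univ.pi (Function.update s i Set.univ)) ×ˢ s i := by
    ext ⟨σ, x⟩
    simp only [mem_preimage, Set.mem_pi, mem_univ, true_implies, mem_prod]
    refine ⟨fun h => ⟨fun j => ?_, by simpa using h i⟩, fun h j => ?_⟩
    · rcases eq_or_ne j i with rfl | hj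
      · simp
      · simpa [hj] using h j
    · rcases eq_or_ne j i with rfl | hj
      · simpa using h.2
      · simpa [hj] using h.1 j
  rw [Measure.map_apply hmeas (MeasurableSet.univ_pi hs), hpre, Measure.prod_prod, Measure.pi_pi,
    ← Finset.mul_prod_erase _ _ (Finset.mem_univ i),
    ← Finset.mul_prod_erase _ (fun j => μ j (s j)) (Finset.mem_univ i)]
  simp only [Function.update_self, measure_univ, one_mul]
  rw [mul_comm]
  congr 1
  refine Finset.prod_congr rfl fun j hj => ?_
  rw [Function.update_of_ne (Finset.ne_of_mem_erase hj)]

end Resampling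

section Gibbs

lemma integral_gibbs {n : ℕ} (μ : Fin n → Measure ℝ) (A : Matrix (Fin n) (Fin n) ℝ)
    (c : Fin n → ℝ) (f : (Fin n → ℝ) → ℝ) :
    ∫ σ, f σ ∂gibbs μ A c = (∫ σ, Real.exp (ham A c σ) ∂Measure.pi μ)⁻¹ *
      ∫ σ, Real.exp (ham A c σ) * f σ ∂Measure.pi μ := by
  have hm := (continuous_ham A c).measurable
  rw [gibbs, integral_smul_measure, integral_withDensity_eq_integral_toReal_smul (by fun_prop)
    (by simp), ENNReal.toReal_inv,
    ENNReal.toReal_ofReal (integral_nonneg fun _ => (Real.exp_pos _).le)]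
  simp only [ENNReal.toReal_ofReal (Real.exp_pos _).le, smul_eq_mul]

variable {n : ℕ} {μ : Fin n → Measure ℝ} [∀ i, IsProbabilityMeasure (μ i)]
  {A : Matrix (Fin n) (Fin n) ℝ} {c : Fin n → ℝ} {g : ℝ → ℝ} {M : ℝ}

lemma ae_pi_abs_le_one (hμ : ∀ i, ∀ᵐ z ∂μ i, |z| ≤ 1) :
    ∀ᵐ σ ∂Measure.pi μ, ∀ i, |σ i| ≤ 1 :=
  ae_all_iff.2 fun i => Measure.tendsto_eval_ae_ae (hμ i)

lemma exists_ae_exp_ham_le (hμ : ∀ i, ∀ᵐ z ∂μ i, |z| ≤ 1) (A : Matrix (Fin n) (Fin n) ℝ)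
    (c : Fin n → ℝ) : ∃ K, ∀ᵐ σ ∂Measure.pi μ, Real.exp (ham A c σ) ≤ K := by
  have hcomp : IsCompact (Set.univ.pi fun _ : Fin n => Set.Icc (-1 : ℝ) 1) :=
    isCompact_univ_pi fun _ => isCompact_Icc
  obtain ⟨K, hK⟩ := hcomp.exists_bound_of_continuousOn
    (Real.continuous_exp.comp (continuous_ham A c)).continuousOn
  refine ⟨K, ?_⟩
  filter_upwards [ae_pi_abs_le_one hμ] with σ hσ
  exact (le_abs_self _).trans (hK σ fun i _ => abs_le.1 (hσ i))

lemma integrable_exp_ham_mul (hμ : ∀ i, ∀ᵐ z ∂μ i, |z| ≤ 1) {f : (Fin n → ℝ) → ℝ}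
    (hf : Measurable f) {L : ℝ} (hL : ∀ σ, |f σ| ≤ L) :
    Integrable (fun σ => Real.exp (ham A c σ) * f σ) (Measure.pi μ) := by
  obtain ⟨K, hK⟩ := exists_ae_exp_ham_le hμ A c
  have hm := (continuous_ham A c).measurable
  refine Integrable.of_bound (by fun_prop) (K * L) ?_
  filter_upwards [hK] with σ hσ
  rw [Real.norm_eq_abs, abs_mul, Real.abs_exp]
  have h1 := (Real.exp_pos _).le.trans hσ
  have h2 := hL σ
  gcongr

lemma integrable_exp_ham (hμ : ∀ i, ∀ᵐ z ∂μ i, |z| ≤ 1) :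
    Integrable (fun σ => Real.exp (ham A c σ)) (Measure.pi μ) := by
  simpa using integrable_exp_ham_mul (A := A) (c := c) (f := fun _ => 1) (L := 1) hμ
    measurable_const (by simp)

lemma isProbabilityMeasure_gibbs (hμ : ∀ i, ∀ᵐ z ∂μ i, |z| ≤ 1) :
    IsProbabilityMeasure (gibbs μ A c) := by
  have hi := integrable_exp_ham (A := A) (c := c) hμ
  refine ⟨?_⟩
  rw [gibbs, Measure.smul_apply, withDensity_apply _ MeasurableSet.univ, Measure.restrict_univ,
    ← ofReal_integral_eq_lintegral_ofReal hi (Eventually.of_forall fun _ => (Real.exp_pos _).le),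
    smul_eq_mul]
  exact ENNReal.inv_mul_cancel (by simpa using integral_exp_pos hi) ENNReal.ofReal_ne_top

lemma ae_gibbs_abs_le_one (hμ : ∀ i, ∀ᵐ z ∂μ i, |z| ≤ 1) :
    ∀ᵐ σ ∂gibbs μ A c, ∀ i, |σ i| ≤ 1 :=
  (Measure.smul_absolutelyContinuous.trans (withDensity_absolutelyContinuous _ _)).ae_le
    (ae_pi_abs_le_one hμ)

lemma measurable_expMean_localField {i : Fin n} (hμ : ∀ᵐ z ∂μ i, |z| ≤ 1) (hg : Measurable g)
    (hM : ∀ x, |g x| ≤ M) : Measurable fun σ => expMean (μ i) g (localField A c σ i) :=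
  (measurable_expMean hμ hg (Eventually.of_forall hM)).comp (continuous_localField A c i).measurable

/-- The value `g(σ_i)` centered at its tilted mean is orthogonal to every bounded function of the
other coordinates. -/
lemma integral_gibbs_mul_centered_eq_zero (hμ : ∀ i, ∀ᵐ z ∂μ i, |z| ≤ 1) (hs : A.IsSymm)
    {i : Fin n} (hd : A i i = 0) (hg : Measurable g) (hM : ∀ x, |g x| ≤ M)
    {Φ : (Fin n → ℝ) → ℝ} (hΦ : Measurable Φ) {L : ℝ} (hL : ∀ σ, |Φ σ| ≤ L)
    (hinv : ∀ σ x, Φ (Function.update σ i x) = Φ σ) :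
    ∫ σ, Φ σ * (g (σ i) - expMean (μ i) g (localField A c σ i)) ∂gibbs μ A c = 0 := by
  have hb := measurable_expMean_localField (A := A) (c := c) (hμ i) hg hM
  have hint : Integrable (fun σ => Real.exp (ham A c σ) *
      (Φ σ * (g (σ i) - expMean (μ i) g (localField A c σ i)))) (Measure.pi μ) := by
    refine integrable_exp_ham_mul (L := L * (2 * M)) hμ (by fun_prop) fun σ => ?_
    rw [abs_mul]
    have h0 := (abs_nonneg _).trans (hL σ)
    have h1 := abs_sub (g (σ i)) (expMean (μ i) g (localField A c σ i))
    have h2 := abs_expMean_le (hμ i) (Eventually.of_forall hM) (localField A c σ i)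
    have h3 := hM (σ i)
    exact mul_le_mul (hL σ) (by linarith) (abs_nonneg _) h0
  have hmp := measurePreserving_update_prod μ i
  have hint' := (hmp.integrable_comp hint.aestronglyMeasurable).2 hint
  rw [integral_gibbs]
  refine mul_eq_zero_of_right _ ?_
  rw [← hmp.map_eq] at hint ⊢
  rw [integral_map hmp.aemeasurable hint.aestronglyMeasurable]
  refine (integral_prod _ hint').trans ?_
  refine integral_eq_zero_of_ae (Eventually.of_forall fun σ => ?_)
  have hx : ∀ x, Real.exp (ham A c (Function.update σ i x)) *
      (Φ (Function.update σ i x) * (g (Function.update σ i x i) -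
        expMean (μ i) g (localField A c (Function.update σ i x) i))) =
      Real.exp (ham A c (Function.update σ i 0)) * Φ σ *
        ((g x - expMean (μ i) g (localField A c σ i)) *
          Real.exp (localField A c σ i * x)) := fun x => by
    rw [hinv, localField_update_self hd, Function.update_self, ham_update hs hd, Real.exp_add]
    ring
  simp only [Function.comp_apply, hx, Pi.zero_apply]
  rw [integral_const_mul,
    integral_sub_expMean_mul_exp (hμ i) hg (Eventually.of_forall hM), mul_zero]

lemma condB_ae_eq_expMean (hμ : ∀ i, ∀ᵐ z ∂μ i, |z| ≤ 1) (hs : A.IsSymm)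
    {i : Fin n} (hd : A i i = 0) (hg : Measurable g) (hM : ∀ x, |g x| ≤ M) :
    condB μ A c g i =ᵐ[gibbs μ A c] fun σ => expMean (μ i) g (localField A c σ i) := by
  have := isProbabilityMeasure_gibbs (A := A) (c := c) hμ
  have hb := measurable_expMean_localField (A := A) (c := c) (hμ i) hg hM
  have hupd : Measurable fun σ : Fin n → ℝ => Function.update σ i 0 := by fun_prop
  have hle : exceptSigma n i ≤ MeasurableSpace.pi := hupd.comap_le
  have hig : Integrable (fun σ => g (σ i)) (gibbs μ A c) :=
    Integrable.of_bound (hg.comp (measurable_pi_apply i)).aestronglyMeasurable M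
      (Eventually.of_forall fun σ => hM _)
  have hib : Integrable (fun σ => expMean (μ i) g (localField A c σ i)) (gibbs μ A c) :=
    Integrable.of_bound hb.aestronglyMeasurable M (Eventually.of_forall fun σ =>
      abs_expMean_le (hμ i) (Eventually.of_forall hM) _)
  refine (ae_eq_condExp_of_forall_setIntegral_eq hle hig (fun s _ _ => hib.integrableOn) ?_ ?_).symm
  · rintro s ⟨t, ht, rfl⟩ -
    have hst : MeasurableSet ((fun σ : Fin n → ℝ => Function.update σ i 0) ⁻¹' t) := hupd ht
    have h0 := integral_gibbs_mul_centered_eq_zero (c := c) hμ hs hd hg hM (L := 1)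
      (Φ := fun σ => t.indicator (fun _ => 1) (Function.update σ i 0))
      ((measurable_const.indicator ht).comp hupd)
      (fun σ => by
        unfold Set.indicator
        split_ifs <;> simp)
      (fun σ x => by simp only [Function.update_idem])
    rw [← sub_eq_zero, ← neg_eq_zero, neg_sub, ← integral_sub hig.integrableOn hib.integrableOn,
      ← integral_indicator hst]
    refine Eq.trans (integral_congr_ae (Eventually.of_forall fun σ => ?_)) h0
    by_cases hσ : Function.update σ i 0 ∈ t
    · have hpre : σ ∈ (fun σ : Fin n → ℝ => Function.update σ i 0) ⁻¹' t := hσ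
      rw [Set.indicator_of_mem hσ, Set.indicator_of_mem hpre, one_mul]
    · have hpre : σ ∉ (fun σ : Fin n → ℝ => Function.update σ i 0) ⁻¹' t := hσ
      rw [Set.indicator_of_notMem hσ, Set.indicator_of_notMem hpre, zero_mul]
  · have heq : (fun σ => expMean (μ i) g (localField A c σ i)) =
        (fun σ => expMean (μ i) g (localField A c σ i)) ∘ fun σ => Function.update σ i 0 := by
      ext σ
      simp only [Function.comp_apply, localField_update_self hd]
    rw [heq]
    exact (hb.comp (comap_measurable _)).aestronglyMeasurable

end Gibbs

section SecondMoment

variable {n : ℕ} {μ : Fin n → Measure ℝ} [∀ i, IsProbabilityMeasure (μ i)]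
  {A : Matrix (Fin n) (Fin n) ℝ} {c : Fin n → ℝ} {g : ℝ → ℝ} {M : ℝ}

lemma measurable_centeredProd_localField {i : Fin n} (hμ : ∀ᵐ z ∂μ i, |z| ≤ 1)
    (hg : Measurable g) (hM : ∀ x, |g x| ≤ M) :
    Measurable fun σ => centeredProd (μ i) g (g (σ i)) (localField A c σ i) := by
  have hb := measurable_expMean_localField (A := A) (c := c) hμ hg hM
  unfold centeredProd
  fun_prop

lemma measurable_centeredProd_localField_update {i : Fin n} (hμ : ∀ᵐ z ∂μ i, |z| ≤ 1)
    (hg : Measurable g) (hM : ∀ x, |g x| ≤ M) (j : Fin n) :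
    Measurable fun σ =>
      centeredProd (μ i) g (g (σ i)) (localField A c (Function.update σ j 0) i) := by
  have hu : Measurable fun σ : Fin n → ℝ => Function.update σ j 0 := by fun_prop
  have hb := (measurable_expMean_localField (A := A) (c := c) hμ hg hM).comp hu
  simp only [Function.comp_def] at hb
  unfold centeredProd
  fun_prop

lemma sq_sum_centeredProd_le (hμ : ∀ i, ∀ᵐ z ∂μ i, |z| ≤ 1) (hs : A.IsSymm) {h : ℝ}
    (hh : 0 ≤ h) (hA : opNorm 2 A ≤ h) (hg : Measurable g) (hM : ∀ x, |g x| ≤ M)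
    (γ : Fin n → ℝ) {σ : Fin n → ℝ} (hσ : ∀ i, |σ i| ≤ 1) :
    (∑ i, γ i * centeredProd (μ i) g (g (σ i)) (localField A c σ i)) ^ 2 ≤
      ∑ i, ∑ j, γ i * γ j *
        (centeredProd (μ i) g (g (σ i)) (localField A c (Function.update σ j 0) i) *
          centeredProd (μ j) g (g (σ j)) (localField A c σ j)) +
      (12 * h + 52 * h ^ 2) * M ^ 4 * ∑ i, γ i ^ 2 := by
  set F : Fin n → ℝ := fun i => centeredProd (μ i) g (g (σ i)) (localField A c σ i) with hF
  set X : Fin n → ℝ := fun i => centeredProdDeriv (μ i) g (g (σ i)) (localField A c σ i) with hX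
  set G : Fin n → Fin n → ℝ := fun i j =>
    centeredProd (μ i) g (g (σ i)) (localField A c (Function.update σ j 0) i) with hG
  have hFb : ∀ i, |F i| ≤ 2 * M ^ 2 := fun i => abs_centeredProd_le (hμ i) hM (hM _) _
  have hXb : ∀ i, |X i| ≤ 6 * M ^ 2 := fun i => abs_centeredProdDeriv_le (hμ i) hM (hM _) _
  have hM2 : 0 ≤ M ^ 2 := sq_nonneg M
  have hT : ∀ i j, |F i - G i j - A i j * σ j * X i| ≤ 26 * M ^ 2 * A i j ^ 2 := fun i j => by
    have h1 := abs_centeredProd_taylor_le (hμ i) hg hM (hM (σ i)) (localField A c σ i)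
      (A i j * (0 - σ j))
    rw [← localField_update] at h1
    rw [← abs_neg]
    calc _ = |G i j - F i - A i j * (0 - σ j) * X i| := by congr 1; ring
      _ ≤ 26 * M ^ 2 * (A i j * (0 - σ j)) ^ 2 := h1
      _ = 26 * M ^ 2 * (A i j ^ 2 * σ j ^ 2) := by ring
      _ ≤ 26 * M ^ 2 * (A i j ^ 2 * 1) := by
          gcongr
          exact (sq_le_one_iff_abs_le_one _).2 (hσ j)
      _ = _ := by ring
  have hterm : ∀ i j, γ i * F i * (γ j * F j) ≤ γ i * γ j * (G i j * F j) +
      γ i * X i * A i j * (γ j * (σ j * F j)) +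
      52 * M ^ 4 * (|γ i| * |γ j| * A i j ^ 2) := fun i j => by
    have h1 : γ i * γ j * ((F i - G i j - A i j * σ j * X i) * F j) ≤
        |γ i| * |γ j| * ((26 * M ^ 2 * A i j ^ 2) * (2 * M ^ 2)) := by
      refine (le_abs_self _).trans ?_
      rw [abs_mul, abs_mul, abs_mul]
      have := hT i j
      have := hFb j
      gcongr
    linarith
  have hlin := sum_mul_mul_le_of_opNorm_le (u := fun i => γ i * X i)
    (v := fun j => γ j * (σ j * F j)) (γ := γ) (a := 6 * M ^ 2) (b := 2 * M ^ 2) hh hA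
    (by positivity) (by positivity)
    (fun i => by
      rw [abs_mul, mul_comm]
      exact mul_le_mul_of_nonneg_right (hXb i) (abs_nonneg _))
    (fun j => by
      rw [abs_mul, mul_comm, abs_mul]
      refine mul_le_mul_of_nonneg_right ?_ (abs_nonneg _)
      exact (mul_le_of_le_one_left (abs_nonneg _) (hσ j)).trans (hFb j))
  have hquad := mul_le_mul_of_nonneg_left (sum_abs_mul_sq_le_of_opNorm_le hs hA γ)
    (show 0 ≤ 52 * M ^ 4 by positivity)
  calc (∑ i, γ i * F i) ^ 2 = ∑ i, ∑ j, γ i * F i * (γ j * F j) := by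
        rw [sq, Finset.sum_mul_sum]
    _ ≤ ∑ i, ∑ j, (γ i * γ j * (G i j * F j) + γ i * X i * A i j * (γ j * (σ j * F j)) +
          52 * M ^ 4 * (|γ i| * |γ j| * A i j ^ 2)) :=
        Finset.sum_le_sum fun i _ => Finset.sum_le_sum fun j _ => hterm i j
    _ = ∑ i, ∑ j, γ i * γ j * (G i j * F j) +
          ∑ i, ∑ j, γ i * X i * A i j * (γ j * (σ j * F j)) +
          52 * M ^ 4 * ∑ i, ∑ j, |γ i| * |γ j| * A i j ^ 2 := by
        simp only [Finset.sum_add_distrib, Finset.mul_sum]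
    _ ≤ _ := by linarith

lemma abs_centeredProd_mul_le (hμ : ∀ i, ∀ᵐ z ∂μ i, |z| ≤ 1) (hM : ∀ x, |g x| ≤ M)
    (i j : Fin n) (x y θ η : ℝ) :
    |centeredProd (μ i) g (g x) θ * centeredProd (μ j) g (g y) η| ≤ 4 * M ^ 4 := by
  rw [abs_mul]
  calc _ ≤ (2 * M ^ 2) * (2 * M ^ 2) :=
        mul_le_mul (abs_centeredProd_le (hμ i) hM (hM _) _)
          (abs_centeredProd_le (hμ j) hM (hM _) _) (abs_nonneg _) (by positivity)
    _ = _ := by ring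

/-- Removing the influence of the `j`-th coordinate makes distinct terms uncorrelated. -/
lemma integral_centeredProd_mul_eq_zero (hμ : ∀ i, ∀ᵐ z ∂μ i, |z| ≤ 1) (hs : A.IsSymm)
    (hd : ∀ i, A i i = 0) (hg : Measurable g) (hM : ∀ x, |g x| ≤ M) {i j : Fin n} (hij : i ≠ j) :
    ∫ σ, centeredProd (μ i) g (g (σ i)) (localField A c (Function.update σ j 0) i) *
      centeredProd (μ j) g (g (σ j)) (localField A c σ j) ∂gibbs μ A c = 0 := by
  have h0 := integral_gibbs_mul_centered_eq_zero (c := c) (i := j) hμ hs (hd j) hg hM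
    (Φ := fun σ => centeredProd (μ i) g (g (σ i)) (localField A c (Function.update σ j 0) i) *
      expMean (μ j) g (localField A c σ j)) (L := 2 * M ^ 2 * M)
    ((measurable_centeredProd_localField_update (hμ i) hg hM j).mul
      (measurable_expMean_localField (hμ j) hg hM))
    (fun σ => by
      rw [abs_mul]
      exact mul_le_mul (abs_centeredProd_le (hμ i) hM (hM _) _)
        (abs_expMean_le (hμ j) (Eventually.of_forall hM) _) (abs_nonneg _) (by positivity))
    (fun σ x => by
      rw [localField_update_self (hd j), Function.update_idem, Function.update_of_ne hij])
  refine Eq.trans (integral_congr_ae (Eventually.of_forall fun σ => ?_)) h0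
  simp only [centeredProd]
  ring

lemma integral_sq_sum_condCentered_le (hμ : ∀ i, ∀ᵐ z ∂μ i, |z| ≤ 1) (hs : A.IsSymm)
    (hd : ∀ i, A i i = 0) {h : ℝ} (hh : 0 ≤ h) (hA : opNorm 2 A ≤ h) (hg : Measurable g)
    (hM : ∀ x, |g x| ≤ M) (γ : Fin n → ℝ) :
    ∫ σ, (∑ i, γ i * (g (σ i) - condB μ A c g i σ) * condB μ A c g i σ) ^ 2 ∂gibbs μ A c ≤
      (4 + 12 * h + 52 * h ^ 2) * M ^ 4 * ∑ i, γ i ^ 2 := by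
  have := isProbabilityMeasure_gibbs (A := A) (c := c) hμ
  set F : Fin n → (Fin n → ℝ) → ℝ := fun i σ =>
    centeredProd (μ i) g (g (σ i)) (localField A c σ i) with hF
  set G : Fin n → Fin n → (Fin n → ℝ) → ℝ := fun i j σ =>
    centeredProd (μ i) g (g (σ i)) (localField A c (Function.update σ j 0) i) with hG
  have hcond : ∀ᵐ σ ∂gibbs μ A c, ∀ i,
      condB μ A c g i σ = expMean (μ i) g (localField A c σ i) :=
    ae_all_iff.2 fun i => condB_ae_eq_expMean hμ hs (hd i) hg hM
  have hFm : ∀ i, Measurable (F i) := fun i => measurable_centeredProd_localField (hμ i) hg hM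
  have hGF : ∀ i j, Integrable (fun σ => G i j σ * F j σ) (gibbs μ A c) := fun i j =>
    Integrable.of_bound (((measurable_centeredProd_localField_update (hμ i) hg hM j).mul
      (hFm j)).aestronglyMeasurable) (4 * M ^ 4)
      (Eventually.of_forall fun σ => abs_centeredProd_mul_le hμ hM _ _ _ _ _ _)
  have hsum : Integrable (fun σ => ∑ i, ∑ j, γ i * γ j * (G i j σ * F j σ)) (gibbs μ A c) :=
    integrable_finsetSum _ fun i _ => integrable_finsetSum _ fun j _ => (hGF i j).const_mul _
  have hdiag : ∀ i, ∑ j, γ i * γ j * ∫ σ, G i j σ * F j σ ∂gibbs μ A c ≤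
      4 * M ^ 4 * γ i ^ 2 := fun i => by
    rw [Finset.sum_eq_single i (fun j _ hji => by
      rw [integral_centeredProd_mul_eq_zero hμ hs hd hg hM hji.symm, mul_zero]) (by simp)]
    have hb : ∫ σ, G i i σ * F i σ ∂gibbs μ A c ≤ 4 * M ^ 4 := by
      refine (integral_mono (hGF i i) (integrable_const (4 * M ^ 4)) fun σ =>
        (le_abs_self _).trans (abs_centeredProd_mul_le hμ hM _ _ _ _ _ _)).trans ?_
      simp
    nlinarith [sq_nonneg (γ i)]
  calc ∫ σ, (∑ i, γ i * (g (σ i) - condB μ A c g i σ) * condB μ A c g i σ) ^ 2 ∂gibbs μ A c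
      ≤ ∫ σ, (∑ i, ∑ j, γ i * γ j * (G i j σ * F j σ) +
          (12 * h + 52 * h ^ 2) * M ^ 4 * ∑ i, γ i ^ 2) ∂gibbs μ A c := by
        refine integral_mono_of_nonneg (Eventually.of_forall fun σ => sq_nonneg _)
          (hsum.add (integrable_const _)) ?_
        filter_upwards [hcond, ae_gibbs_abs_le_one hμ] with σ hσ hσ1
        refine le_of_eq_of_le ?_ (sq_sum_centeredProd_le (c := c) hμ hs hh hA hg hM γ hσ1)
        simp only [hσ, mul_assoc, centeredProd]
    _ = ∑ i, ∑ j, γ i * γ j * ∫ σ, G i j σ * F j σ ∂gibbs μ A c +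
          (12 * h + 52 * h ^ 2) * M ^ 4 * ∑ i, γ i ^ 2 := by
        rw [integral_add hsum (integrable_const _), integral_const, probReal_univ, one_smul,
          integral_finsetSum _ fun i _ => integrable_finsetSum _ fun j _ => (hGF i j).const_mul _]
        congr 1
        refine Finset.sum_congr rfl fun i _ => ?_
        rw [integral_finsetSum _ fun j _ => (hGF i j).const_mul _]
        simp only [integral_const_mul]
    _ ≤ 4 * M ^ 4 * ∑ i, γ i ^ 2 + (12 * h + 52 * h ^ 2) * M ^ 4 * ∑ i, γ i ^ 2 :=
        add_le_add ((Finset.sum_le_sum fun i _ => hdiag i).trans_eq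
          (Finset.mul_sum _ _ _).symm) le_rfl
    _ = _ := by ring

end SecondMoment

/-- Second-moment bound for conditionally centered statistics weighted by the
conditional means (Lemma 4.3(b)). -/
theorem condCentered_weighted_secondMoment (h Mg : ℝ) (hh : 0 < h) :
    ∃ C : ℝ, 0 < C ∧
      ∀ n : ℕ, 0 < n → ∀ μ : Fin n → Measure ℝ, (∀ i, GoodBase (μ i)) →
      ∀ A : Matrix (Fin n) (Fin n) ℝ, A.IsSymm → (∀ i, A i i = 0) → opNorm 2 A ≤ h →
      ∀ c γ : Fin n → ℝ, ∀ g : ℝ → ℝ, Measurable g → (∀ x, |g x| ≤ Mg) →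
        ∫ σ, (∑ i, γ i * (g (σ i) - condB μ A c g i σ) * condB μ A c g i σ) ^ 2
            ∂(gibbs μ A c) ≤
          C * ∑ i, γ i ^ 2 := by
  refine ⟨(4 + 12 * h + 52 * h ^ 2) * Mg ^ 4 + 1, by positivity, ?_⟩
  intro n _ μ hμ A hs hd hA c γ g hg hM
  have := fun i => (hμ i).prob
  have hsupp : ∀ i, ∀ᵐ z ∂μ i, |z| ≤ 1 := fun i => by
    filter_upwards [mem_ae_iff.2 (hμ i).supp] with z hz using abs_le.2 hz
  refine (integral_sq_sum_condCentered_le hsupp hs hd hh.le hA hg hM γ).trans ?_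
  have : 0 ≤ ∑ i, γ i ^ 2 := Finset.sum_nonneg fun i _ => sq_nonneg _
  linarith
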